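/- Suppose all entries of diag(ᾱ) Σ_S diag(ᾱ) are strictly positive (α_iα_jρ_{i,j} > 0 for all i,j). Define σ²_{Z*_m} = max_{j<m} (β_jβ_m/ρ_{j,m})P² − P for m = 2,3,…,M. Then any channel with noise powers σ²_{Z_1} ≥ σ²_{Z_2} ≥ … ≥ σ²_{Z_M} > 0 satisfying σ²_{Z_m} ≥ σ²_{Z*_m} for m = 2,…,M is matched, i.e. Σ^{(0)} is positive semidefinite. -/

import Mathlib

open Matrix BigOperators Finset

/-- The auxiliary covariance matrix `Σ_V` of the broadcast matching analysis. -/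
noncomputable def SigmaV {M : ℕ} (α β B : Fin M → ℝ) : Matrix (Fin M) (Fin M) ℝ :=
  Matrix.of fun i j =>
    if i = j then
      (β i / α i) * (B i * ∑ k ∈ Finset.Iio i, α k * β k +
        ∑ k ∈ Finset.Ioi i, α k * β k * B k)
    else
      -(β i * β j * B (max i j))

/-- The matrix `Σ^{(0)} = Σ_V − Σ_S + P β̄ β̄ᵀ` of the matching condition. -/
noncomputable def Sigma0 {M : ℕ} (SigS : Matrix (Fin M) (Fin M) ℝ)
    (α β : Fin M → ℝ) (P : ℝ) (B : Fin M → ℝ) : Matrix (Fin M) (Fin M) ℝ :=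
  SigmaV α β B - SigS + P • vecMulVec β β

/-- A real symmetric matrix with a kernel vector `α` without zero entries, such that the
off-diagonal entries of `diag(α) A diag(α)` are nonpositive, is positive semidefinite. -/
theorem posSemidef_of_mulVec_eq_zero_of_offDiag_nonpos {ι : Type*} [Fintype ι]
    {A : Matrix ι ι ℝ} {α : ι → ℝ} (hA : A.IsSymm) (hα : ∀ i, α i ≠ 0)
    (hker : A *ᵥ α = 0) (hoff : ∀ i j, i ≠ j → α i * α j * A i j ≤ 0) :
    A.PosSemidef := by
  refine Matrix.PosSemidef.of_dotProduct_mulVec_nonneg ?_ fun x => ?_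
  · rw [Matrix.IsHermitian, Matrix.conjTranspose_eq_transpose_of_trivial]
    exact hA
  have hrow : ∀ i, ∑ j, A i j * α j = 0 := fun i => congrFun hker i
  have hcol : ∀ j, ∑ i, A i j * α i = 0 := fun j => by
    rw [← hrow j]
    exact Finset.sum_congr rfl fun i _ => by rw [hA.apply]
  have hleft : ∑ i, ∑ j, α i * α j * A i j * (x i / α i) ^ 2 = 0 :=
    Finset.sum_eq_zero fun i _ => by
      have h : ∀ j, α i * α j * A i j * (x i / α i) ^ 2 =
          α i * (x i / α i) ^ 2 * (A i j * α j) := fun j => by ring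
      simp only [h, ← Finset.mul_sum, hrow, mul_zero]
  have hright : ∑ i, ∑ j, α i * α j * A i j * (x j / α j) ^ 2 = 0 := by
    rw [Finset.sum_comm]
    refine Finset.sum_eq_zero fun j _ => ?_
    have h : ∀ i, α i * α j * A i j * (x j / α j) ^ 2 =
        α j * (x j / α j) ^ 2 * (A i j * α i) := fun i => by ring
    simp only [h, ← Finset.mul_sum, hcol, mul_zero]
  have hsq : ∑ i, ∑ j, α i * α j * A i j * (x i / α i - x j / α j) ^ 2 ≤ 0 := by
    refine Finset.sum_nonpos fun i _ => Finset.sum_nonpos fun j _ => ?_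
    rcases eq_or_ne i j with rfl | hij
    · simp
    · exact mul_nonpos_of_nonpos_of_nonneg (hoff i j hij) (sq_nonneg _)
  have hexp : ∑ i, ∑ j, α i * α j * A i j * (x i / α i - x j / α j) ^ 2 =
      -2 * (star x ⬝ᵥ (A *ᵥ x)) := by
    have h : ∀ i j, α i * α j * A i j * (x i / α i - x j / α j) ^ 2 =
        α i * α j * A i j * (x i / α i) ^ 2 + α i * α j * A i j * (x j / α j) ^ 2 +
          -2 * (x i * (A i j * x j)) := fun i j => by
      have hi := hα i
      have hj := hα j
      field_simp
      ring
    simp only [h, Finset.sum_add_distrib, hleft, hright, zero_add, ← Finset.mul_sum]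
    rfl
  linarith

theorem SigmaV_isSymm {M : ℕ} (α β B : Fin M → ℝ) : (SigmaV α β B).IsSymm := by
  refine Matrix.IsSymm.ext fun i j => ?_
  rcases eq_or_ne i j with rfl | hij
  · rfl
  · simp [SigmaV, hij, hij.symm, max_comm, mul_comm]

theorem SigmaV_mulVec_eq_zero {M : ℕ} {α : Fin M → ℝ} (hα : ∀ m, α m ≠ 0)
    (β B : Fin M → ℝ) : SigmaV α β B *ᵥ α = 0 := by
  funext m
  have hsplit : ∀ f : Fin M → ℝ,
      ∑ j, f j = f m + (∑ j ∈ Finset.Iio m, f j + ∑ j ∈ Finset.Ioi m, f j) := fun f => by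
    rw [← Finset.sum_union (Finset.disjoint_left.2 fun j hj hj' =>
        lt_asymm (Finset.mem_Iio.1 hj) (Finset.mem_Ioi.1 hj')),
      ← Finset.add_sum_erase _ f (Finset.mem_univ m)]
    congr 2
    ext j
    simp
  have hlt : ∑ j ∈ Finset.Iio m, SigmaV α β B m j * α j =
      -(β m * (B m * ∑ j ∈ Finset.Iio m, α j * β j)) := by
    simp only [Finset.mul_sum, ← Finset.sum_neg_distrib]
    refine Finset.sum_congr rfl fun j hj => ?_
    have hj := Finset.mem_Iio.1 hj
    simp only [SigmaV, Matrix.of_apply, hj.ne', if_false, max_eq_left hj.le]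
    ring
  have hgt : ∑ j ∈ Finset.Ioi m, SigmaV α β B m j * α j =
      -(β m * ∑ j ∈ Finset.Ioi m, α j * β j * B j) := by
    simp only [Finset.mul_sum, ← Finset.sum_neg_distrib]
    refine Finset.sum_congr rfl fun j hj => ?_
    have hj := Finset.mem_Ioi.1 hj
    simp only [SigmaV, Matrix.of_apply, hj.ne, if_false, max_eq_right hj.le]
    ring
  have hm := hα m
  change ∑ j, SigmaV α β B m j * α j = 0
  rw [hsplit, hlt, hgt]
  simp only [SigmaV, Matrix.of_apply, if_true]
  field_simp
  ring

/-- Corollary 3: if all entries of `diag(ᾱ) Σ_S diag(ᾱ)` are strictly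
positive, then any channel with decreasing positive noise powers satisfying
`σ²_{Z_m} ≥ max_{j<m} (β_jβ_m/ρ_{j,m})P² − P` for every `m ≥ 2` is matched, i.e.
`Σ^{(0)}` is positive semidefinite. -/
theorem stmt_9 {M : ℕ} (hM : 2 ≤ M)
    (SigS : Matrix (Fin M) (Fin M) ℝ) (hS : SigS.PosDef)
    (α : Fin M → ℝ) (hα : ∀ m, α m ≠ 0)
    (P : ℝ) (hP : P = α ⬝ᵥ (SigS *ᵥ α)) (hPpos : 0 < P)
    (β : Fin M → ℝ) (hβ : β = fun m => (SigS *ᵥ α) m / P)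
    (hpos : ∀ i j : Fin M, 0 < α i * α j * SigS i j)
    (σZ : Fin M → ℝ) (hσmono : ∀ i j : Fin M, i ≤ j → σZ j ≤ σZ i)
    (hσpos : ∀ m, 0 < σZ m)
    (hthr : ∀ m : Fin M, ∀ j ∈ Finset.Iio m, β j * β m / SigS j m * P ^ 2 - P ≤ σZ m) :
    (Sigma0 SigS α β P (fun m => P * σZ m / (P + σZ m))).PosSemidef := by
  have hSsymm : SigS.IsSymm := by
    have h := hS.isHermitian
    rwa [Matrix.IsHermitian, Matrix.conjTranspose_eq_transpose_of_trivial] at h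
  have hSα : SigS *ᵥ α = P • β := by
    funext m
    simp only [hβ, Pi.smul_apply, smul_eq_mul]
    field_simp
  have hβα : β ⬝ᵥ α = 1 := by
    have h : P * (β ⬝ᵥ α) = P := by
      rw [← smul_eq_mul, ← smul_dotProduct, ← hSα, dotProduct_comm, ← hP]
    exact mul_left_cancel₀ hPpos.ne' (h.trans (mul_one P).symm)
  set B : Fin M → ℝ := fun m => P * σZ m / (P + σZ m) with hB
  have hsymm : (Sigma0 SigS α β P B).IsSymm :=
    ((SigmaV_isSymm α β B).sub hSsymm).add
      (Matrix.IsSymm.smul (Matrix.transpose_vecMulVec β β) P)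
  have hlt : ∀ j m, j < m → α j * α m * Sigma0 SigS α β P B j m ≤ 0 := fun j m hjm => by
    have hent : Sigma0 SigS α β P B j m =
        β j * β m * P ^ 2 / (P + σZ m) - SigS j m := by
      have hne : P + σZ m ≠ 0 := (add_pos hPpos (hσpos m)).ne'
      simp only [Sigma0, SigmaV, Matrix.add_apply, Matrix.sub_apply, Matrix.of_apply,
        hjm.ne, if_false, max_eq_right hjm.le, Matrix.smul_apply, Matrix.vecMulVec_apply,
        smul_eq_mul, hB]
      field_simp
      ring
    have hD : 0 < P + σZ m := add_pos hPpos (hσpos m)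
    have hρ : SigS j m ≠ 0 := fun h => by simpa [h] using hpos j m
    have hle : β j * β m / SigS j m * P ^ 2 ≤ P + σZ m := by
      linarith [hthr m j (Finset.mem_Iio.2 hjm)]
    have hmul := mul_le_mul_of_nonneg_left hle (hpos j m).le
    have hcancel : α j * α m * SigS j m * (β j * β m / SigS j m * P ^ 2) =
        α j * α m * (β j * β m * P ^ 2) := by
      field_simp
    rw [hcancel, ← div_le_iff₀ hD] at hmul
    rw [hent, mul_sub, ← mul_div_assoc]
    linarith
  refine posSemidef_of_mulVec_eq_zero_of_offDiag_nonpos hsymm hα ?_ fun i j hij => ?_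
  · rw [Sigma0, Matrix.add_mulVec, Matrix.sub_mulVec, SigmaV_mulVec_eq_zero hα, hSα,
      Matrix.smul_mulVec, Matrix.vecMulVec_mulVec, hβα]
    simp
  · rcases lt_or_gt_of_ne hij with h | h
    · exact hlt i j h
    · rw [mul_comm (α i), ← hsymm.apply]
      exact hlt j i h
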